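/- Let s ∈ (0,1) and m ≥ 1, and let g be nonnegative, radially non-increasing, symmetric, and integrable on ℝ^N. Then the infimum value E_{s,g}[m] := inf{P_s(E) + V_g(E) : |E| = m} satisfies m^{-1} E_{s,g}[m] ≤ |B₁|^{-(N-s)/N} P_s(B₁) + 2‖g‖_{L^1(ℝ^N)}; in particular m^{-1} E_{s,g}[m] is bounded uniformly in m ≥ 1. -/

import Mathlib

open MeasureTheory ENNReal Set

noncomputable def fracKer (N : ℕ) (s : ℝ) (x : EuclideanSpace ℝ (Fin N)) : ℝ≥0∞ :=
  ENNReal.ofReal (‖x‖ ^ (-((N : ℝ) + s)))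

noncomputable def fracPer (N : ℕ) (s : ℝ) (E : Set (EuclideanSpace ℝ (Fin N))) : ℝ≥0∞ :=
  ∫⁻ x in E, ∫⁻ y in Eᶜ, fracKer N s (x - y)

noncomputable def rieszPot (N : ℕ) (g : EuclideanSpace ℝ (Fin N) → ℝ)
    (E : Set (EuclideanSpace ℝ (Fin N))) : ℝ≥0∞ :=
  ∫⁻ x in E, ∫⁻ y in E, ENNReal.ofReal (g (x - y))

noncomputable def minVal (N : ℕ) (s : ℝ) (g : EuclideanSpace ℝ (Fin N) → ℝ) (m : ℝ) : ℝ≥0∞ :=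
  sInf {e : ℝ≥0∞ | ∃ E : Set (EuclideanSpace ℝ (Fin N)),
    MeasurableSet E ∧ volume E = ENNReal.ofReal m ∧ e = fracPer N s E + rieszPot N g E}

theorem setLIntegral_eq_mul_comp_smul {N : ℕ} (f : EuclideanSpace ℝ (Fin N) → ℝ≥0∞)
    (A : Set (EuclideanSpace ℝ (Fin N))) {r : ℝ} (hr : 0 < r) :
    ∫⁻ x in A, f x = ENNReal.ofReal (r ^ N) * ∫⁻ x in (r • ·) ⁻¹' A, f (r • x) := by
  have hemb : MeasurableEmbedding (fun x : EuclideanSpace ℝ (Fin N) ↦ r • x) :=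
    (Homeomorph.smulOfNeZero r hr.ne').measurableEmbedding
  have hpos : 0 < r ^ N := pow_pos hr N
  rw [← hemb.lintegral_map, ← hemb.restrict_map,
    Measure.map_addHaar_smul volume hr.ne', finrank_euclideanSpace_fin,
    Measure.restrict_smul, lintegral_smul_measure, smul_eq_mul, ← mul_assoc,
    ← ENNReal.ofReal_mul hpos.le, abs_of_pos (inv_pos.2 hpos),
    mul_inv_cancel₀ hpos.ne', ENNReal.ofReal_one, one_mul]

theorem fracKer_smul {N : ℕ} (s : ℝ) (x : EuclideanSpace ℝ (Fin N)) {r : ℝ} (hr : 0 < r) :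
    fracKer N s (r • x) = ENNReal.ofReal (r ^ (-((N : ℝ) + s))) * fracKer N s x := by
  rw [fracKer, fracKer, norm_smul, Real.norm_of_nonneg hr.le,
    Real.mul_rpow hr.le (norm_nonneg x), ENNReal.ofReal_mul (by positivity)]

theorem smul_preimage_ball_zero {N : ℕ} {r : ℝ} (hr : 0 < r) :
    (r • ·) ⁻¹' Metric.ball (0 : EuclideanSpace ℝ (Fin N)) r = Metric.ball 0 1 := by
  ext x
  simp only [mem_preimage, mem_ball_zero_iff, norm_smul, Real.norm_of_nonneg hr.le]
  exact mul_lt_iff_lt_one_right hr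

theorem setLIntegral_compl_ball_fracKer {N : ℕ} (s : ℝ) {r : ℝ} (hr : 0 < r) :
    ∫⁻ x in (Metric.ball (0 : EuclideanSpace ℝ (Fin N)) r)ᶜ, fracKer N s x
      = ENNReal.ofReal (r ^ (-s)) *
        ∫⁻ x in (Metric.ball (0 : EuclideanSpace ℝ (Fin N)) 1)ᶜ, fracKer N s x := by
  rw [setLIntegral_eq_mul_comp_smul _ _ hr, preimage_compl, smul_preimage_ball_zero hr]
  simp_rw [fracKer_smul s _ hr]
  rw [lintegral_const_mul' _ _ ofReal_ne_top, ← mul_assoc, ← ENNReal.ofReal_mul (by positivity),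
    ← Real.rpow_natCast, ← Real.rpow_add hr]
  ring_nf

theorem fracPer_ball {N : ℕ} (s : ℝ) {r : ℝ} (hr : 0 < r) :
    fracPer N s (Metric.ball 0 r)
      = ENNReal.ofReal (r ^ ((N : ℝ) - s)) * fracPer N s (Metric.ball 0 1) := by
  have inner (x : EuclideanSpace ℝ (Fin N)) :
      ∫⁻ y in (Metric.ball 0 r)ᶜ, fracKer N s (r • x - y)
        = ENNReal.ofReal (r ^ (-s)) * ∫⁻ y in (Metric.ball 0 1)ᶜ, fracKer N s (x - y) := by
    rw [setLIntegral_eq_mul_comp_smul _ _ hr, preimage_compl, smul_preimage_ball_zero hr]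
    simp_rw [← smul_sub, fracKer_smul s _ hr]
    rw [lintegral_const_mul' _ _ ofReal_ne_top, ← mul_assoc,
      ← ENNReal.ofReal_mul (by positivity), ← Real.rpow_natCast, ← Real.rpow_add hr]
    ring_nf
  rw [fracPer, setLIntegral_eq_mul_comp_smul _ _ hr, smul_preimage_ball_zero hr]
  simp_rw [inner]
  rw [lintegral_const_mul' _ _ ofReal_ne_top, ← mul_assoc, ← ENNReal.ofReal_mul (by positivity),
    ← Real.rpow_natCast, ← Real.rpow_add hr, ← sub_eq_add_neg, fracPer]

theorem setLIntegral_compl_unit_ball_fracKer_lt_top {N : ℕ} {s : ℝ} (hs : 0 < s) :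
    ∫⁻ x in (Metric.ball (0 : EuclideanSpace ℝ (Fin N)) 1)ᶜ, fracKer N s x < ∞ := by
  have hp : 0 < (N : ℝ) + s := by positivity
  calc ∫⁻ x in (Metric.ball (0 : EuclideanSpace ℝ (Fin N)) 1)ᶜ, fracKer N s x
      ≤ ∫⁻ x in (Metric.ball (0 : EuclideanSpace ℝ (Fin N)) 1)ᶜ,
          ENNReal.ofReal (2 ^ ((N : ℝ) + s)) *
            ENNReal.ofReal ((1 + ‖x‖) ^ (-((N : ℝ) + s))) := by
        refine setLIntegral_mono' measurableSet_ball.compl fun x hx ↦ ?_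
        have h1 : 1 ≤ ‖x‖ := by simpa using hx
        rw [fracKer, ← ENNReal.ofReal_mul (by positivity)]
        refine ENNReal.ofReal_le_ofReal ?_
        rw [Real.rpow_neg (norm_nonneg x), Real.rpow_neg (by positivity), ← div_eq_mul_inv,
          ← Real.div_rpow (by norm_num) (by positivity), ← Real.inv_rpow (norm_nonneg x)]
        refine Real.rpow_le_rpow (by positivity) ?_ hp.le
        rw [inv_eq_one_div, div_le_div_iff₀ (by positivity) (by positivity)]
        linarith
    _ ≤ ∫⁻ x : EuclideanSpace ℝ (Fin N), ENNReal.ofReal (2 ^ ((N : ℝ) + s)) *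
            ENNReal.ofReal ((1 + ‖x‖) ^ (-((N : ℝ) + s))) := setLIntegral_le_lintegral _ _
    _ < ∞ := by
        rw [lintegral_const_mul' _ _ ofReal_ne_top]
        exact ENNReal.mul_lt_top ofReal_lt_top
          (finite_integral_one_add_norm (by simpa using hs))

theorem integrableOn_unit_ball_one_sub_norm_rpow {N : ℕ} (hN : 0 < N) {s : ℝ} (hs : s < 1) :
    IntegrableOn (fun x : EuclideanSpace ℝ (Fin N) ↦ (1 - ‖x‖) ^ (-s)) (Metric.ball 0 1) := by
  have : Nonempty (Fin N) := ⟨⟨0, hN⟩⟩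
  rw [integrableOn_fun_norm_addHaar volume (f := fun t : ℝ ↦ (1 - t) ^ (-s))]
  have h : IntegrableOn (fun t : ℝ ↦ (1 - t) ^ (-s)) (Ioo 0 1) := by
    have := (intervalIntegral.intervalIntegrable_rpow' (a := 1) (b := 0)
      (r := -s) (by linarith)).comp_sub_left 1
    rw [sub_self, sub_zero, intervalIntegrable_iff_integrableOn_Ioo_of_le zero_le_one] at this
    exact this
  refine Integrable.mono h (by fun_prop) ?_
  filter_upwards [ae_restrict_mem measurableSet_Ioo] with t ht
  rw [norm_smul, norm_pow, Real.norm_of_nonneg ht.1.le]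
  exact mul_le_of_le_one_left (norm_nonneg _) (pow_le_one₀ ht.1.le ht.2.le)

theorem fracPer_unit_ball_lt_top {N : ℕ} (hN : 0 < N) {s : ℝ} (hs : s ∈ Ioo (0 : ℝ) 1) :
    fracPer N s (Metric.ball 0 1) < ∞ := by
  have inner (x : EuclideanSpace ℝ (Fin N)) (hx : x ∈ Metric.ball 0 1) :
      ∫⁻ y in (Metric.ball 0 1)ᶜ, fracKer N s (x - y)
        ≤ ENNReal.ofReal ((1 - ‖x‖) ^ (-s)) *
          ∫⁻ y in (Metric.ball (0 : EuclideanSpace ℝ (Fin N)) 1)ᶜ, fracKer N s y := by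
    rw [mem_ball_zero_iff] at hx
    rw [← setLIntegral_compl_ball_fracKer s (sub_pos.2 hx),
      ← lintegral_indicator measurableSet_ball.compl,
      ← lintegral_indicator measurableSet_ball.compl,
      ← lintegral_sub_left_eq_self
        (indicator (Metric.ball (0 : EuclideanSpace ℝ (Fin N)) (1 - ‖x‖))ᶜ (fracKer N s)) x]
    refine lintegral_mono (Set.indicator_le fun y hy ↦ ?_ : (_ : _ → ℝ≥0∞) ≤ _)
    have hy1 : 1 ≤ ‖y‖ := by simpa using hy
    have hmem : x - y ∈ (Metric.ball (0 : EuclideanSpace ℝ (Fin N)) (1 - ‖x‖))ᶜ := by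
      simp only [mem_compl_iff, mem_ball_zero_iff, not_lt]
      linarith [norm_sub_norm_le y x, norm_sub_rev x y]
    rw [indicator_of_mem hmem]
  refine (setLIntegral_mono' measurableSet_ball inner).trans_lt ?_
  rw [lintegral_mul_const' _ _ (setLIntegral_compl_unit_ball_fracKer_lt_top hs.1).ne]
  exact ENNReal.mul_lt_top
    (integrableOn_unit_ball_one_sub_norm_rpow hN hs.2).lintegral_lt_top
    (setLIntegral_compl_unit_ball_fracKer_lt_top hs.1)

theorem rieszPot_le {N : ℕ} {g : EuclideanSpace ℝ (Fin N) → ℝ} (hg0 : 0 ≤ᵐ[volume] g)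
    (hgint : Integrable g) (E : Set (EuclideanSpace ℝ (Fin N))) :
    rieszPot N g E ≤ ENNReal.ofReal (∫ x, g x) * volume E := by
  rw [ofReal_integral_eq_lintegral_ofReal hgint hg0, ← setLIntegral_const]
  refine lintegral_mono fun x ↦ (setLIntegral_le_lintegral _ _).trans_eq ?_
  exact lintegral_sub_left_eq_self (fun y ↦ ENNReal.ofReal (g y)) x

/-- For `m ≥ 1` and `g` nonnegative, radially non-increasing, symmetric,
integrable, `m⁻¹ E_{s,g}[m] ≤ |B₁|^{-(N-s)/N} P_s(B₁) + 2‖g‖_{L¹}`; in particular the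
left-hand side is bounded uniformly in `m ≥ 1`. -/
theorem minVal_linear_bound (N : ℕ) (hN : 0 < N) (s : ℝ) (hs : s ∈ Set.Ioo (0:ℝ) 1)
    (g : EuclideanSpace ℝ (Fin N) → ℝ)
    (hg0 : ∀ x : EuclideanSpace ℝ (Fin N), x ≠ 0 → 0 ≤ g x)
    (hgmono : ∀ x : EuclideanSpace ℝ (Fin N), x ≠ 0 → ∀ l : ℝ, 1 ≤ l → g (l • x) ≤ g x)
    (hgsymm : ∀ x : EuclideanSpace ℝ (Fin N), x ≠ 0 → g (-x) = g x)
    (hgint : Integrable g volume)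
    (m : ℝ) (hm : 1 ≤ m) :
    minVal N s g m / ENNReal.ofReal m
      ≤ ENNReal.ofReal
          ((volume (Metric.ball (0 : EuclideanSpace ℝ (Fin N)) 1)).toReal
              ^ (-(((N : ℝ) - s) / N))
            * (fracPer N s (Metric.ball (0 : EuclideanSpace ℝ (Fin N)) 1)).toReal
          + 2 * ∫ x, g x) := by
  have : Nonempty (Fin N) := ⟨⟨0, hN⟩⟩
  have hm0 : 0 < m := one_pos.trans_le hm
  have hN' : (0 : ℝ) < N := Nat.cast_pos.2 hN
  have hgae : 0 ≤ᵐ[volume] g := by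
    filter_upwards [Measure.ae_ne volume (0 : EuclideanSpace ℝ (Fin N))] with x hx using hg0 x hx
  have hI : 0 ≤ ∫ x, g x := integral_nonneg_of_ae hgae
  set V := (volume (Metric.ball (0 : EuclideanSpace ℝ (Fin N)) 1)).toReal with hV
  have hV0 : 0 < V :=
    ENNReal.toReal_pos (Metric.measure_ball_pos volume _ one_pos).ne' measure_ball_lt_top.ne
  set P := (fracPer N s (Metric.ball (0 : EuclideanSpace ℝ (Fin N)) 1)).toReal with hP
  have hP0 : 0 ≤ P := ENNReal.toReal_nonneg
  set r := (m / V) ^ (1 / (N : ℝ)) with hr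
  have hmV : 0 < m / V := div_pos hm0 hV0
  have hr0 : 0 < r := Real.rpow_pos_of_pos hmV _
  have hrN : r ^ N = m / V := by
    rw [hr, ← Real.rpow_natCast, ← Real.rpow_mul hmV.le, one_div_mul_cancel hN'.ne',
      Real.rpow_one]
  have hvol : volume (Metric.ball (0 : EuclideanSpace ℝ (Fin N)) r) = ENNReal.ofReal m := by
    rw [Measure.addHaar_ball_of_pos volume _ hr0, finrank_euclideanSpace_fin, hrN,
      ← ENNReal.ofReal_toReal measure_ball_lt_top.ne, ← hV, ← ENNReal.ofReal_mul hmV.le,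
      div_mul_cancel₀ _ hV0.ne']
  have hrpow : r ^ ((N : ℝ) - s) ≤ V ^ (-(((N : ℝ) - s) / N)) * m := by
    rw [hr, ← Real.rpow_mul hmV.le, one_div_mul_eq_div, Real.div_rpow hm0.le hV0.le,
      Real.rpow_neg hV0.le, div_eq_inv_mul]
    gcongr
    refine Real.rpow_le_self_of_one_le hm ?_
    rw [div_le_one hN']
    linarith [hs.1]
  have hper : fracPer N s (Metric.ball (0 : EuclideanSpace ℝ (Fin N)) r)
      ≤ ENNReal.ofReal (V ^ (-(((N : ℝ) - s) / N)) * P * m) := by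
    rw [fracPer_ball s hr0, ← ENNReal.ofReal_toReal (fracPer_unit_ball_lt_top hN hs).ne, ← hP,
      ← ENNReal.ofReal_mul (by positivity), mul_right_comm]
    gcongr
  have hpot : rieszPot N g (Metric.ball (0 : EuclideanSpace ℝ (Fin N)) r)
      ≤ ENNReal.ofReal (2 * (∫ x, g x) * m) := by
    refine (rieszPot_le hgae hgint _).trans ?_
    rw [hvol, ← ENNReal.ofReal_mul hI]
    gcongr
    linarith
  refine ENNReal.div_le_of_le_mul ?_
  rw [← ENNReal.ofReal_mul (by positivity), add_mul,
    ENNReal.ofReal_add (by positivity) (by positivity)]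
  have hmin : minVal N s g m ≤ fracPer N s (Metric.ball 0 r) + rieszPot N g (Metric.ball 0 r) :=
    sInf_le ⟨_, measurableSet_ball, hvol, rfl⟩
  exact hmin.trans (add_le_add hper hpot)
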